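/- Let F_q be a finite field and f ∈ F_q[T] an irreducible polynomial of degree d. If d ≤ q, then there exists a polynomial g ∈ F_q[T], coprime to f, such that g/f is normal. -/

import Mathlib

noncomputable section

namespace PaperCF

variable {K : Type*} [Field K]

/-- The element `T` of `K((T⁻¹))`, where `K((T⁻¹))` is modeled as the field
`LaurentSeries K` of Laurent series in the variable `t = T⁻¹`. -/
def Tvar (K : Type*) [Field K] : LaurentSeries K := (HahnSeries.single (-1 : ℤ) (1 : K))

/-- The embedding of `K[T]` into `K((T⁻¹))`, sending the polynomial variable to `T = t⁻¹`. -/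
def emb : Polynomial K →+* LaurentSeries K := (Polynomial.aeval (Tvar K)).toRingHom

/-- The polynomial part `⌊α⌋` of a formal Laurent series `α ∈ K((T⁻¹))`. -/
def polyPart (α : LaurentSeries K) : Polynomial K :=
  ∑ i ∈ Finset.range ((-α.order).toNat + 1), Polynomial.monomial i (α.coeff (-(i : ℤ)))

/-- The complete quotients `αₙ` of the regular continued fraction expansion of `α`
(with the convention `0⁻¹ = 0`, so that `cq α n = 0` for all `n` past the end of a
finite expansion). -/
def cq (α : LaurentSeries K) : ℕ → LaurentSeries K
  | 0 => α
  | n + 1 => (cq α n - emb (polyPart (cq α n)))⁻¹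

/-- The partial quotients `aₙ = ⌊αₙ⌋` of the regular continued fraction expansion of `α`. -/
def pq (α : LaurentSeries K) (n : ℕ) : Polynomial K := polyPart (cq α n)

/-- The continuants `(pₙ, qₙ)` of the regular continued fraction expansion of `α`. -/
def cont (α : LaurentSeries K) : ℕ → Polynomial K × Polynomial K
  | 0 => (pq α 0, 1)
  | 1 => (pq α 1 * pq α 0 + 1, pq α 1)
  | n + 2 => (pq α (n + 2) * (cont α (n + 1)).1 + (cont α n).1,
              pq α (n + 2) * (cont α (n + 1)).2 + (cont α n).2)

/-- `pₙ`. -/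
def contP (α : LaurentSeries K) (n : ℕ) : Polynomial K := (cont α n).1

/-- `qₙ`. -/
def contQ (α : LaurentSeries K) (n : ℕ) : Polynomial K := (cont α n).2

/-- The `n`-th partial quotient (and hence the `n`-th convergent) of `α` genuinely exists. -/
def ConvAt (α : LaurentSeries K) (n : ℕ) : Prop := n = 0 ∨ cq α n ≠ 0

/-- `K(α) = sup_{n ≥ 1} deg aₙ`, as an extended natural number. -/
def KK (α : LaurentSeries K) : ℕ∞ :=
  ⨆ n : {n : ℕ // 1 ≤ n ∧ cq α n ≠ 0}, ((pq α n.1).natDegree : ℕ∞)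

/-- `ōK(α) = limsup_n deg aₙ`. -/
def KKbar (α : LaurentSeries K) : ℕ∞ :=
  Filter.limsup (fun n => ((pq α n).natDegree : ℕ∞)) Filter.atTop

/-- `α` is a rational function, i.e. an element of `K(T) ⊆ K((T⁻¹))`. -/
def IsRat (α : LaurentSeries K) : Prop :=
  ∃ p q : Polynomial K, q ≠ 0 ∧ α * emb q = emb p

/-- Two Laurent series are equivalent if they differ by a Möbius transformation with
matrix in `GL₂(K[T])`. -/
def MEquiv (α β : LaurentSeries K) : Prop :=
  ∃ a b c d : Polynomial K, IsUnit (a * d - b * c) ∧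
    emb c * α + emb d ≠ 0 ∧ β = (emb a * α + emb b) / (emb c * α + emb d)

end PaperCF

namespace PaperCF

open Polynomial

section Expansion

variable {K : Type*} [Field K]

theorem emb_monomial (n : ℕ) (c : K) :
    emb (monomial n c) = HahnSeries.single (-(n : ℤ)) c := by
  have h : Tvar K ^ n = HahnSeries.single (-(n : ℤ)) 1 := by
    simp [Tvar, HahnSeries.single_pow]
  change aeval (Tvar K) (monomial n c) = _
  rw [aeval_monomial, h, LaurentSeries.algebraMap_apply, HahnSeries.C_apply,
    HahnSeries.single_mul_single, zero_add, mul_one]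

theorem coeff_emb (p : K[X]) (i : ℕ) : (emb p).coeff (-(i : ℤ)) = p.coeff i := by
  induction p using Polynomial.induction_on' with
  | add p q hp hq => simp [hp, hq]
  | monomial n c =>
    rw [emb_monomial, coeff_monomial, HahnSeries.coeff_single]
    simp [eq_comm]

theorem emb_injective : Function.Injective (emb : K[X] → LaurentSeries K) := by
  intro p q h
  ext i
  rw [← coeff_emb, h, coeff_emb]

theorem emb_ne_zero {p : K[X]} (hp : p ≠ 0) : emb p ≠ 0 :=
  (map_ne_zero_iff _ emb_injective).2 hp

theorem order_emb {p : K[X]} (hp : p ≠ 0) : (emb p).order = -(p.natDegree : ℤ) := by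
  apply le_antisymm
  · apply HahnSeries.order_le_of_coeff_ne_zero
    rw [coeff_emb]
    simpa using hp
  · by_contra! h
    obtain ⟨i, hi⟩ : ∃ i : ℕ, (emb p).order = -(i : ℤ) :=
      ⟨(-(emb p).order).toNat, by omega⟩
    have hne := HahnSeries.coeff_order_eq_zero.not.2 (emb_ne_zero hp)
    rw [hi, coeff_emb, coeff_eq_zero_of_natDegree_lt (by omega)] at hne
    exact hne rfl

theorem coeff_polyPart (α : LaurentSeries K) (i : ℕ) :
    (polyPart α).coeff i = α.coeff (-(i : ℤ)) := by
  simp only [polyPart, finsetSum_coeff, coeff_monomial, Finset.sum_ite_eq', Finset.mem_range]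
  split_ifs with h
  · rfl
  · rw [HahnSeries.coeff_eq_zero_of_lt_order]
    omega

theorem coeff_emb_div_eq_zero {p q : K[X]} (h : p.degree < q.degree) (i : ℕ) :
    (emb p / emb q).coeff (-(i : ℤ)) = 0 := by
  rcases eq_or_ne p 0 with rfl | hp
  · simp
  have hq : q ≠ 0 := ne_zero_of_degree_gt h
  have hd := natDegree_lt_natDegree hp h
  have hx : emb p / emb q ≠ 0 := div_ne_zero (emb_ne_zero hp) (emb_ne_zero hq)
  have ho := HahnSeries.order_mul (emb_ne_zero hq) hx
  rw [mul_div_cancel₀ _ (emb_ne_zero hq), order_emb hp, order_emb hq] at ho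
  apply HahnSeries.coeff_eq_zero_of_lt_order
  omega

theorem emb_div_eq {q : K[X]} (hq : q ≠ 0) (p : K[X]) :
    emb p / emb q = emb (p / q) + emb (p % q) / emb q := by
  have := emb_ne_zero hq
  conv_lhs => rw [← EuclideanDomain.div_add_mod p q]
  rw [map_add, map_mul]
  field_simp

theorem polyPart_emb_div {q : K[X]} (hq : q ≠ 0) (p : K[X]) :
    polyPart (emb p / emb q) = p / q := by
  ext i
  rw [coeff_polyPart, emb_div_eq hq, HahnSeries.coeff_add, coeff_emb,
    coeff_emb_div_eq_zero (EuclideanDomain.mod_lt p hq), add_zero]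

theorem natDegree_div_of_ne_zero {p q : K[X]} (hq : q ≠ 0) (h : q.natDegree < p.natDegree) :
    (p / q).natDegree = p.natDegree - q.natDegree := by
  have hlt := degree_lt_degree h
  have hpq : p / q ≠ 0 := (Polynomial.div_eq_zero_iff hq).not.2 hlt.not_gt
  have hadd := degree_add_div hq hlt.le
  rw [← degree_mul] at hadd
  have := natDegree_eq_of_degree_eq hadd
  rw [natDegree_mul hq hpq] at this
  omega

theorem cq_succ_of_eq {α : LaurentSeries K} {n : ℕ} {p q : K[X]} (hq : q ≠ 0)
    (h : cq α n = emb p / emb q) : cq α (n + 1) = emb q / emb (p % q) := by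
  rw [cq, h, polyPart_emb_div hq]
  nth_rewrite 1 [emb_div_eq hq]
  rw [add_sub_cancel_left, inv_div]

theorem cq_eq_zero_of_le {α : LaurentSeries K} {m n : ℕ} (h : cq α m = 0) (hmn : m ≤ n) :
    cq α n = 0 := by
  induction n, hmn using Nat.le_induction with
  | base => exact h
  | succ n _ ih => simp [cq, ih, polyPart]

/-- Every nonzero `u` of degree less than `deg f` makes the residues `v` of `u * g` modulo `f`
as large as the degree of `u` permits: `deg u + deg v ≥ deg f - 1`. -/
def IsBadlyApproximable (f g : K[X]) : Prop :=
  ∀ u v : K[X], u ≠ 0 → u.natDegree < f.natDegree → f ∣ u * g - v →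
    v ≠ 0 ∧ f.natDegree ≤ u.natDegree + v.natDegree + 1

theorem IsBadlyApproximable.exists_cq_eq {f g : K[X]} (hfg : IsBadlyApproximable f g)
    (hg : g.degree < f.degree) (n : ℕ) (hn : n < f.natDegree) :
    ∃ r' r u' u : K[X], cq (emb g / emb f) (n + 1) = emb r' / emb r ∧ r ≠ 0 ∧
      r'.natDegree + n = f.natDegree ∧ r.natDegree + n + 1 = f.natDegree ∧
      u ≠ 0 ∧ u.natDegree = n ∧ u'.degree < u.degree ∧
      f ∣ u * g - r ∧ f ∣ u' * g - r' := by
  have hf : f ≠ 0 := ne_zero_of_degree_gt hg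
  induction n with
  | zero =>
    obtain ⟨hg0, hd⟩ := hfg 1 g one_ne_zero (by simpa using hn) (by simp)
    have := natDegree_lt_natDegree hg0 hg
    rw [natDegree_one] at hd
    refine ⟨f, g, 0, 1, ?_, hg0, by omega, by omega, one_ne_zero, natDegree_one, by simp,
      by simp, by simp⟩
    rw [cq_succ_of_eq hf rfl, (mod_eq_self_iff hf).2 hg]
  | succ n ih =>
    obtain ⟨r', r, u', u, hcq, hr, hr'n, hrn, hu, hun, hu', hur, hur'⟩ := ih (by omega)
    have hmod := EuclideanDomain.mod_add_div r' r
    have hquot : (r' / r).natDegree = 1 := by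
      rw [natDegree_div_of_ne_zero hr (by omega)]; omega
    have hquot0 : r' / r ≠ 0 := by
      rintro h; simp [h] at hquot
    have hdeg : (r' / r * u).natDegree = n + 1 := by
      rw [natDegree_mul hquot0 hu]; omega
    have hlt : u'.degree < (r' / r * u).degree := by
      refine hu'.trans (degree_lt_degree ?_); omega
    have hw : (u' - r' / r * u).degree = (r' / r * u).degree := degree_sub_eq_right_of_degree_lt hlt
    have hwn : (u' - r' / r * u).natDegree = n + 1 := by
      rw [natDegree_eq_of_degree_eq hw, hdeg]
    have hw0 : u' - r' / r * u ≠ 0 := by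
      rintro h; simp [h] at hwn
    have hdvd : f ∣ (u' - r' / r * u) * g - r' % r := by
      convert hur'.sub (hur.mul_left (r' / r)) using 1
      linear_combination -hmod
    obtain ⟨hs0, hs⟩ := hfg _ _ hw0 (by omega) hdvd
    have hsr := natDegree_lt_natDegree hs0 (EuclideanDomain.mod_lt r' hr)
    refine ⟨r, r' % r, u, u' - r' / r * u, cq_succ_of_eq hr hcq, hs0, by omega, by omega, hw0, hwn,
      ?_, hdvd, hur⟩
    rw [hw]
    exact degree_lt_degree (by omega)

theorem IsBadlyApproximable.KK_eq_one {f g : K[X]} (hfg : IsBadlyApproximable f g)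
    (hg : g.degree < f.degree) (hf : 0 < f.natDegree) : KK (emb g / emb f) = 1 := by
  have hpq : ∀ n < f.natDegree, cq (emb g / emb f) (n + 1) ≠ 0 ∧
      (pq (emb g / emb f) (n + 1)).natDegree = 1 := by
    intro n hn
    obtain ⟨r', r, -, -, hcq, hr, hr'n, hrn, -⟩ := hfg.exists_cq_eq hg n hn
    have hr' : r' ≠ 0 := by rintro rfl; simp at hr'n; omega
    refine ⟨hcq ▸ div_ne_zero (emb_ne_zero hr') (emb_ne_zero hr), ?_⟩
    rw [pq, hcq, polyPart_emb_div hr, natDegree_div_of_ne_zero hr (by omega)]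
    omega
  have hend : cq (emb g / emb f) (f.natDegree + 1) = 0 := by
    obtain ⟨r', r, -, -, hcq, hr, -, hrn, -⟩ := hfg.exists_cq_eq hg (f.natDegree - 1) (by omega)
    have hdvd : r' % r = 0 :=
      EuclideanDomain.mod_eq_zero.2 (isUnit_iff_degree_eq_zero.2
        (by rw [degree_eq_natDegree hr, show r.natDegree = 0 by omega, Nat.cast_zero])).dvd
    have := cq_succ_of_eq hr hcq
    rwa [hdvd, map_zero, div_zero, Nat.sub_add_cancel hf] at this
  apply le_antisymm
  · refine iSup_le ?_
    rintro ⟨n, hn, hne⟩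
    obtain ⟨n, rfl⟩ := Nat.exists_eq_add_of_le' hn
    have hlt : n < f.natDegree := by
      by_contra! h
      exact hne (cq_eq_zero_of_le hend (by omega))
    simp [(hpq n hlt).2]
  · refine le_iSup_of_le ⟨1, le_rfl, (hpq 0 hf).1⟩ ?_
    simp [(hpq 0 hf).2]

end Expansion

section Counting

variable {K : Type*} [Field K]

/-- The nonzero polynomials of degree less than `n`. -/
abbrev NonzeroDegreeLT (K : Type*) [Field K] (n : ℕ) : Type _ := {p : degreeLT K n // p ≠ 0}

theorem card_nonzeroDegreeLT [Fintype K] (n : ℕ) :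
    Nat.card (NonzeroDegreeLT K n) = Fintype.card K ^ n - 1 := by
  classical
  have : Fintype (degreeLT K n) := Fintype.ofEquiv _ (degreeLTEquiv K n).toEquiv.symm
  rw [Nat.card_eq_fintype_card, Fintype.card_subtype_compl, Fintype.card_subtype_eq,
    Fintype.card_congr (degreeLTEquiv K n).toEquiv]
  simp

theorem sum_mul_pow_sub_one_lt {q d : ℕ} (hd : 0 < d) (hq : 2 ≤ q) (hdq : d ≤ q) :
    ∑ k : Fin (d - 1), (q ^ (k.1 + 1) - 1) * (q ^ (d - 1 - k.1) - 1) <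
      (q ^ d - 1) * (q - 1) := by
  have hqd : q ≤ q ^ d := Nat.le_self_pow hd.ne' q
  have hterm : ∀ k ∈ (Finset.univ : Finset (Fin (d - 1))),
      (q ^ (k.1 + 1) - 1) * (q ^ (d - 1 - k.1) - 1) ≤ q ^ d - 2 := by
    intro k _
    have ha : q ≤ q ^ (k.1 + 1) := Nat.le_self_pow (by omega) q
    have hb : q ≤ q ^ (d - 1 - k.1) := Nat.le_self_pow (by omega) q
    have hab : q ^ (k.1 + 1) * q ^ (d - 1 - k.1) = q ^ d := by
      rw [← pow_add]; congr 1; omega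
    rw [← hab]
    generalize q ^ (k.1 + 1) = a at *
    generalize q ^ (d - 1 - k.1) = b at *
    obtain ⟨a, rfl⟩ := Nat.exists_eq_add_of_le' (hq.trans ha)
    obtain ⟨b, rfl⟩ := Nat.exists_eq_add_of_le' (hq.trans hb)
    apply Nat.le_sub_of_add_le
    simp only [Nat.add_sub_assoc, Nat.reduceSub, Nat.reduceLeDiff]
    nlinarith
  have hsum := Finset.sum_le_card_nsmul _ _ _ hterm
  rw [Finset.card_univ, Fintype.card_fin, smul_eq_mul] at hsum
  calc _ ≤ (d - 1) * (q ^ d - 2) := hsum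
    _ ≤ (q - 1) * (q ^ d - 2) := Nat.mul_le_mul_right _ (by omega)
    _ < (q - 1) * (q ^ d - 1) := Nat.mul_lt_mul_of_pos_left (by omega) (by omega)
    _ = _ := mul_comm _ _

theorem not_dvd_of_natDegree_lt {f u : K[X]} (hu : u ≠ 0) (h : u.natDegree < f.natDegree) :
    ¬ f ∣ u := fun hd => (natDegree_le_of_dvd hd hu).not_gt h

theorem exists_isBadlyApproximable [Fintype K] {f : K[X]} (hf : Irreducible f)
    (hq : f.natDegree ≤ Fintype.card K) :
    ∃ g : K[X], g ≠ 0 ∧ g.degree < f.degree ∧ IsBadlyApproximable f g := by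
  classical
  by_contra! hbad
  have hdeg : f.degree = f.natDegree := degree_eq_natDegree hf.ne_zero
  have hlt {n : ℕ} {p : K[X]} (hp : p ≠ 0) : p ∈ degreeLT K n ↔ p.natDegree < n := by
    rw [mem_degreeLT, natDegree_lt_iff_degree_lt hp]
  have key : ∀ g : NonzeroDegreeLT K f.natDegree, ∃ (k : Fin (f.natDegree - 1))
      (u : NonzeroDegreeLT K (k.1 + 1)) (v : NonzeroDegreeLT K (f.natDegree - 1 - k.1)),
      f ∣ u.1.1 * g.1.1 - v.1.1 := by
    rintro ⟨⟨g, hg⟩, hg0⟩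
    replace hg0 : g ≠ 0 := by simpa using hg0
    have h := hbad g hg0 (hdeg ▸ mem_degreeLT.1 hg)
    unfold IsBadlyApproximable at h
    push Not at h
    obtain ⟨u, v, hu, hud, huv, hv⟩ := h
    have hv0 : v ≠ 0 := by
      rintro rfl
      rw [sub_zero] at huv
      rcases hf.prime.dvd_or_dvd huv with h | h
      · exact not_dvd_of_natDegree_lt hu hud h
      · exact not_dvd_of_natDegree_lt hg0 ((hlt hg0).1 hg) h
    have := hv hv0
    refine ⟨⟨u.natDegree, by omega⟩, ⟨⟨u, (hlt hu).2 (by simp)⟩, by simpa using hu⟩,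
      ⟨⟨v, (hlt hv0).2 (by simp; omega)⟩, by simpa using hv0⟩, huv⟩
  choose k u v huv using key
  let F : NonzeroDegreeLT K f.natDegree × Kˣ → Σ k : Fin (f.natDegree - 1),
      NonzeroDegreeLT K (k.1 + 1) × NonzeroDegreeLT K (f.natDegree - 1 - k.1) := fun x =>
    ⟨k x.1, ⟨(x.2 : K) • (u x.1).1, smul_ne_zero x.2.ne_zero (u x.1).2⟩,
      ⟨(x.2 : K) • (v x.1).1, smul_ne_zero x.2.ne_zero (v x.1).2⟩⟩
  have hF : Function.Injective F := by
    rintro ⟨g, c⟩ ⟨g', c'⟩ h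
    have h1 : C (c : K) * (u g).1.1 = C (c' : K) * (u g').1.1 := by
      have := congrArg (fun y => (y.2.1.1.1 : K[X])) h
      simpa [F, smul_eq_C_mul] using this
    have h2 : C (c : K) * (v g).1.1 = C (c' : K) * (v g').1.1 := by
      have := congrArg (fun y => (y.2.2.1.1 : K[X])) h
      simpa [F, smul_eq_C_mul] using this
    have hu0 : (u g).1.1 ≠ 0 := by simpa using (u g).2
    have hd : f ∣ C (c : K) * (u g).1.1 * (g.1.1 - g'.1.1) := by
      convert ((huv g).mul_left (C (c : K))).sub ((huv g').mul_left (C (c' : K))) using 1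
      linear_combination (-g'.1.1) * h1 + h2
    have hcu : ¬ f ∣ C (c : K) * (u g).1.1 := by
      apply not_dvd_of_natDegree_lt (mul_ne_zero (C_ne_zero.2 c.ne_zero) hu0)
      rw [natDegree_C_mul c.ne_zero]
      have := (hlt hu0).1 (u g).1.2
      have := (k g).2
      omega
    have hgg : g = g' := by
      apply Subtype.ext
      apply Subtype.ext
      rw [← sub_eq_zero]
      apply eq_zero_of_dvd_of_degree_lt ((hf.prime.dvd_or_dvd hd).resolve_left hcu)
      rw [hdeg]
      exact mem_degreeLT.1 (sub_mem g.1.2 g'.1.2)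
    subst hgg
    rw [Prod.mk.injEq]
    exact ⟨rfl, Units.ext (C_injective (mul_right_cancel₀ hu0 h1))⟩
  have hfin (n : ℕ) : Finite (NonzeroDegreeLT K n) :=
    have := Finite.of_equiv _ (degreeLTEquiv K n).toEquiv.symm
    inferInstance
  have hcard := Nat.card_le_card_of_injective F hF
  rw [Nat.card_prod, Nat.card_sigma, card_nonzeroDegreeLT, Nat.card_eq_fintype_card,
    Fintype.card_units] at hcard
  simp only [Nat.card_prod, card_nonzeroDegreeLT] at hcard
  exact hcard.not_gt (sum_mul_pow_sub_one_lt hf.natDegree_pos Fintype.one_lt_card hq)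

end Counting

end PaperCF

open PaperCF in
/-- **Friesen.** If `f ∈ F_q[T]` is irreducible of degree `d ≤ q`, then
there exists `g` coprime to `f` such that `g/f` is normal. -/
theorem zaremba_finite_field_irreducible {K : Type*} [Field K] [Fintype K]
    (f : Polynomial K) (hf : Irreducible f)
    (hq : f.natDegree ≤ Fintype.card K) :
    ∃ g : Polynomial K, IsCoprime g f ∧ KK (emb g / emb f) = 1 := by
  obtain ⟨g, hg0, hg, hfg⟩ := exists_isBadlyApproximable hf hq
  refine ⟨g, ?_, hfg.KK_eq_one hg hf.natDegree_pos⟩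
  exact (hf.coprime_iff_not_dvd.2 (Polynomial.not_dvd_of_degree_lt hg0 hg)).symm
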